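/- Let X be a real-valued random variable on a probability space with X ∈ [a, b] almost surely, where a < 0 < b, and with E[X] = 0, E[X²] = m₂, E[X³] = 0, and E[X⁴] = m₄. Then for every real s > 0, E[exp(sX)] ≤ (1 + 6m₂/a² + m₄/a⁴) · exp( (s²/8) · Φ(a,b)² ), where Φ(a,b) = (b−a)/2 if |a| < b and Φ(a,b) = √(|a|·b) if |a| ≥ b. -/

import Mathlib

open MeasureTheory Real ProbabilityTheory
open scoped ProbabilityTheory

noncomputable def Phi' (a b : ℝ) : ℝ := if |a| < b then (b - a) / 2 else Real.sqrt (|a| * b)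

lemma two_mul_exp_sub_one_le {v : ℝ} (hv : 0 ≤ v) :
    2 * (exp v - 1) ≤ v * (exp v + 1) := by
  have hd : ∀ x : ℝ, HasDerivAt (fun v : ℝ => v * (exp v + 1) - 2 * (exp v - 1))
      (1 * (exp x + 1) + x * exp x - 2 * exp x) x := fun x =>
    ((hasDerivAt_id' x).mul ((Real.hasDerivAt_exp x).add_const 1)).sub
      (((Real.hasDerivAt_exp x).sub_const 1).const_mul 2)
  have hmono : Monotone (fun v : ℝ => v * (exp v + 1) - 2 * (exp v - 1)) := by
    refine monotone_of_hasDerivAt_nonneg hd fun x => ?_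
    have h1 : 1 - x ≤ exp (-x) := Real.one_sub_le_exp_neg x
    have h2 : exp (-x) * exp x = 1 := by rw [← Real.exp_add]; simp
    have h3 := mul_le_mul_of_nonneg_right h1 (Real.exp_pos x).le
    show 0 ≤ _
    linarith
  have h := hmono hv
  simp only [Real.exp_zero] at h
  linarith

/-- A differential inequality for the two-point moment generating function
yields a sub-Gaussian bound. -/
lemma two_point_mgf_le_of_deriv_le {b c D : ℝ}
    (h : ∀ t : ℝ, 0 ≤ t → b * c * (exp (t * b) - exp (-(t * c))) ≤
      D * t * (b * exp (-(t * c)) + c * exp (t * b))) {t : ℝ} (ht : 0 ≤ t) :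
    b * exp (-(t * c)) + c * exp (t * b) ≤ (b + c) * exp (t ^ 2 * D / 2) := by
  set f : ℝ → ℝ := fun t =>
    (b * exp (-(t * c)) + c * exp (t * b)) * exp (-(t ^ 2 * D / 2)) with hf
  have hd : ∀ x : ℝ, HasDerivAt f
      ((b * (exp (-(x * c)) * -(1 * c)) + c * (exp (x * b) * (1 * b))) * exp (-(x ^ 2 * D / 2)) +
        (b * exp (-(x * c)) + c * exp (x * b)) *
          (exp (-(x ^ 2 * D / 2)) * -(((2 : ℕ) * x ^ (2 - 1)) * D / 2))) x := fun x =>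
    ((((((hasDerivAt_id' x).mul_const c).neg).exp.const_mul b).add
      ((((hasDerivAt_id' x).mul_const b)).exp.const_mul c)).mul
      ((((hasDerivAt_pow 2 x).mul_const D).div_const 2).neg).exp)
  have hanti : AntitoneOn f (Set.Ici 0) := by
    refine antitoneOn_of_deriv_nonpos (convex_Ici 0)
      (fun x _ => (hd x).continuousAt.continuousWithinAt)
      (fun x _ => (hd x).differentiableAt.differentiableWithinAt) fun x hx => ?_
    rw [interior_Ici] at hx
    rw [(hd x).deriv]
    have h1 := mul_le_mul_of_nonneg_right (h x (le_of_lt hx)) (Real.exp_pos (-(x ^ 2 * D / 2))).le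
    norm_num
    linarith
  have h0 := hanti (Set.mem_Ici.2 le_rfl) (Set.mem_Ici.2 ht) ht
  have h2 : exp (-(t ^ 2 * D / 2)) * exp (t ^ 2 * D / 2) = 1 := by rw [← Real.exp_add]; simp
  have h3 := mul_le_mul_of_nonneg_right h0 (Real.exp_pos (t ^ 2 * D / 2)).le
  simp only [hf, mul_assoc, h2] at h3
  simpa using h3

lemma two_point_mgf_le_exp_mul {b c : ℝ} (hb : 0 < b) (hbc : b ≤ c) {t : ℝ} (ht : 0 ≤ t) :
    b * exp (-(t * c)) + c * exp (t * b) ≤ (b + c) * exp (t ^ 2 * (c * b) / 2) := by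
  refine two_point_mgf_le_of_deriv_le (fun t ht => ?_) ht
  have hc : 0 < c := hb.trans_le hbc
  have hu : 0 ≤ t * (b + c) := by positivity
  have hE : exp (t * b) = exp (-(t * c)) * exp (t * (b + c)) := by
    rw [← Real.exp_add]; ring_nf
  have hk := two_mul_exp_sub_one_le hu
  have h1 : 1 ≤ exp (t * (b + c)) := Real.one_le_exp hu
  rw [hE]
  set E := exp (t * (b + c))
  set N := exp (-(t * c))
  have hN : 0 < N := Real.exp_pos _
  have h2 : 0 ≤ t * (c - b) * (E - 1) :=
    mul_nonneg (mul_nonneg ht (sub_nonneg.2 hbc)) (sub_nonneg.2 h1)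
  have h3 : E - 1 ≤ t * (b + c * E) := by linarith
  have h4 := mul_le_mul_of_nonneg_left h3 (by positivity : 0 ≤ b * c * N)
  linarith

lemma two_point_mgf_le_exp_sq {b c : ℝ} (hb : 0 < b) (hc : 0 < c) {t : ℝ} (ht : 0 ≤ t) :
    b * exp (-(t * c)) + c * exp (t * b) ≤ (b + c) * exp (t ^ 2 * ((b + c) / 2) ^ 2 / 2) := by
  refine two_point_mgf_le_of_deriv_le (fun t ht => ?_) ht
  have hv : 0 ≤ t * (b + c) / 2 := by positivity
  have hE : exp (t * b) = exp (-(t * c)) * exp (t * (b + c) / 2) ^ 2 := by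
    rw [← Real.exp_nat_mul, ← Real.exp_add]; push_cast; ring_nf
  have hk := two_mul_exp_sub_one_le hv
  rw [hE]
  set w := exp (t * (b + c) / 2)
  set N := exp (-(t * c))
  have hN : 0 < N := Real.exp_pos _
  have hw : 0 < w := Real.exp_pos _
  have h1 : b * c * (1 + w) ^ 2 ≤ (b + c) * (b + c * w ^ 2) := by
    linarith [sq_nonneg (b - c * w)]
  have h2 := mul_le_mul_of_nonneg_left h1 (by positivity : 0 ≤ N * t * (b + c) / 4)
  have h3 := mul_le_mul_of_nonneg_left hk (by positivity : 0 ≤ N * (b * c) * (1 + w) / 2)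
  linarith

lemma two_point_mgf_le_Phi' {a b : ℝ} (ha : a < 0) (hb : 0 < b) {t : ℝ} (ht : 0 ≤ t) :
    (b * exp (t * a) - a * exp (t * b)) / (b - a) ≤ exp (t ^ 2 * Phi' a b ^ 2 / 2) := by
  rw [div_le_iff₀ (by linarith), mul_comm (exp _)]
  unfold Phi'
  split_ifs with h
  · have := two_point_mgf_le_exp_sq hb (neg_pos.2 ha) ht
    simpa [sub_eq_add_neg] using this
  · rw [Real.sq_sqrt (by positivity), abs_of_neg ha]
    rw [abs_of_neg ha, not_lt] at h
    have := two_point_mgf_le_exp_mul hb h ht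
    simpa [sub_eq_add_neg] using this

lemma exp_mul_le_chord {a b : ℝ} (hab : a < b) (t : ℝ) {x : ℝ} (hx : x ∈ Set.Icc a b) :
    exp (t * x) ≤ (b * exp (t * a) - a * exp (t * b)) / (b - a) +
      (exp (t * b) - exp (t * a)) / (b - a) * x := by
  have hba : 0 < b - a := sub_pos.2 hab
  have h := convexOn_exp.2 (Set.mem_univ (t * a)) (Set.mem_univ (t * b))
    (div_nonneg (sub_nonneg.2 hx.2) hba.le) (div_nonneg (sub_nonneg.2 hx.1) hba.le)
    (by field_simp; ring)
  simp only [smul_eq_mul] at h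
  have e1 : (b - x) / (b - a) * (t * a) + (x - a) / (b - a) * (t * b) = t * x := by
    field_simp; ring
  rw [e1] at h
  refine h.trans_eq ?_
  field_simp
  ring

theorem stmt_10 {Ω : Type*} [MeasureSpace Ω] [IsProbabilityMeasure (ℙ : Measure Ω)]
    (X : Ω → ℝ) (hX : Measurable X) (a b : ℝ) (ha : a < 0) (hb : 0 < b)
    (hmem : ∀ᵐ ω, X ω ∈ Set.Icc a b)
    (hmean : ∫ ω, X ω = 0) (m₂ : ℝ) (hm₂ : m₂ = ∫ ω, (X ω) ^ 2)
    (hm3 : ∫ ω, (X ω) ^ 3 = 0) (m₄ : ℝ) (hm₄ : m₄ = ∫ ω, (X ω) ^ 4)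
    (s : ℝ) (hs : 0 < s) :
    ∫ ω, Real.exp (s * X ω) ≤
      (1 + 6 * m₂ / a ^ 2 + m₄ / a ^ 4) * Real.exp (s ^ 2 / 8 * (Phi' a b) ^ 2) := by
  have hba : 0 < b - a := by linarith
  have hint : ∀ n : ℕ, Integrable (fun ω => X ω ^ n) (ℙ : Measure Ω) := fun n => by
    refine Integrable.of_bound (hX.pow_const n).aestronglyMeasurable (max |a| |b| ^ n) ?_
    filter_upwards [hmem] with ω hω
    rw [norm_pow, Real.norm_eq_abs]
    exact pow_le_pow_left₀ (abs_nonneg _) (abs_le_max_abs_abs hω.1 hω.2) n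
  have ht : 0 ≤ s / 4 := by positivity
  have hA := two_point_mgf_le_Phi' ha hb ht
  set A := (b * exp (s / 4 * a) - a * exp (s / 4 * b)) / (b - a) with hAdef
  set B := (exp (s / 4 * b) - exp (s / 4 * a)) / (b - a) with hBdef
  have hA0 : 0 ≤ A := div_nonneg (by nlinarith [exp_pos (s / 4 * a), exp_pos (s / 4 * b)]) hba.le
  have hB0 : 0 ≤ B := div_nonneg (sub_nonneg.2 (exp_le_exp.2 (by nlinarith))) hba.le
  have hBA : B ≤ A / (-a) := by
    rw [le_div_iff₀ (neg_pos.2 ha), hAdef, hBdef, div_mul_eq_mul_div]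
    refine div_le_div_of_nonneg_right ?_ hba.le
    nlinarith [exp_pos (s / 4 * a)]
  have hB2 : B ^ 2 ≤ A ^ 2 / a ^ 2 := by
    simpa [div_pow] using pow_le_pow_left₀ hB0 hBA 2
  have hB4 : B ^ 4 ≤ A ^ 4 / a ^ 4 := by
    simpa [div_pow, Even.neg_pow (by decide : Even 4)] using pow_le_pow_left₀ hB0 hBA 4
  have hm2 : 0 ≤ m₂ := hm₂ ▸ integral_nonneg fun ω => by positivity
  have hm4 : 0 ≤ m₄ := hm₄ ▸ integral_nonneg fun ω => by positivity
  have hX1 : Integrable X (ℙ : Measure Ω) := by simpa using hint 1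
  have hi1 : Integrable (fun ω => A ^ 4 + 4 * A ^ 3 * B * X ω) (ℙ : Measure Ω) :=
    (integrable_const _).add (hX1.const_mul _)
  have hi2 : Integrable (fun ω => A ^ 4 + 4 * A ^ 3 * B * X ω + 6 * A ^ 2 * B ^ 2 * X ω ^ 2)
      (ℙ : Measure Ω) := hi1.add ((hint 2).const_mul _)
  have hi3 : Integrable (fun ω => A ^ 4 + 4 * A ^ 3 * B * X ω + 6 * A ^ 2 * B ^ 2 * X ω ^ 2 +
      4 * A * B ^ 3 * X ω ^ 3) (ℙ : Measure Ω) := hi2.add ((hint 3).const_mul _)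
  have hi4 := hi3.add ((hint 4).const_mul (B ^ 4))
  have hA4 : A ^ 4 ≤ exp (s ^ 2 / 8 * Phi' a b ^ 2) := by
    refine (pow_le_pow_left₀ hA0 hA 4).trans_eq ?_
    rw [← Real.exp_nat_mul]; push_cast; ring_nf
  calc ∫ ω, Real.exp (s * X ω)
      ≤ ∫ ω, (A ^ 4 + 4 * A ^ 3 * B * X ω + 6 * A ^ 2 * B ^ 2 * X ω ^ 2 +
          4 * A * B ^ 3 * X ω ^ 3 + B ^ 4 * X ω ^ 4) := by
        refine integral_mono_of_nonneg (ae_of_all _ fun ω => (exp_pos _).le) hi4 ?_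
        filter_upwards [hmem] with ω hω
        have h := pow_le_pow_left₀ (exp_pos _).le
          (exp_mul_le_chord (by linarith : a < b) (s / 4) hω) 4
        rw [← Real.exp_nat_mul] at h
        refine (le_of_eq ?_).trans (h.trans_eq ?_)
        · push_cast; ring_nf
        · rw [← hAdef, ← hBdef]; ring
    _ = A ^ 4 + 6 * A ^ 2 * B ^ 2 * m₂ + B ^ 4 * m₄ := by
        rw [integral_add hi3 ((hint 4).const_mul _), integral_add hi2 ((hint 3).const_mul _),
          integral_add hi1 ((hint 2).const_mul _),
          integral_add (integrable_const _) (hX1.const_mul _)]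
        simp only [integral_const_mul, hmean, hm3, ← hm₂, ← hm₄]
        simp
    _ ≤ A ^ 4 + 6 * A ^ 2 * (A ^ 2 / a ^ 2) * m₂ + A ^ 4 / a ^ 4 * m₄ := by gcongr
    _ = (1 + 6 * m₂ / a ^ 2 + m₄ / a ^ 4) * A ^ 4 := by ring
    _ ≤ _ := by gcongr
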